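/- Preservation of no unspecified receptions: if neither RS(S1) nor RS(S2) contains an unspecified reception configuration, then RS(S) contains no unspecified reception configuration, where S = S1 ⋈_{H,K} S2 is the composed system. -/

import Mathlib

/- Common formalization of Communicating Finite State Machines (CFSMs),
communicating systems, gateways and their composition, following
"Global Types with Internal Delegation" / GTIR paper definitions. -/

namespace GTIR

/-- Polarity of an action: `!` (send) or `?` (receive). -/
inductive Pol : Type
  | bang
  | query
deriving DecidableEq

/-- Dual polarity: swap `!` and `?`. -/
def Pol.dual : Pol → Pol
  | .bang => .query
  | .query => .bang

/-- Actions over roles `R` and messages `A`: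
`snd s r a` is `sr!a` (s sends `a` to r), `rcv s r a` is `sr?a`
(r receives/consumes `a` sent by s). -/
inductive Act (R A : Type) : Type
  | snd : R → R → A → Act R A
  | rcv : R → R → A → Act R A

/-- The action is a send action. -/
def Act.isSend {R A : Type} : Act R A → Prop
  | .snd _ _ _ => True
  | .rcv _ _ _ => False

/-- The action is a receive action. -/
def Act.isRecv {R A : Type} : Act R A → Prop
  | .snd _ _ _ => False
  | .rcv _ _ _ => True

/-- Erase the channel name of an action: `pq!a ↦ !a`, `pq?a ↦ ?a`. -/
def Act.noC {R A : Type} : Act R A → Pol × A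
  | .snd _ _ a => (.bang, a)
  | .rcv _ _ a => (.query, a)

/-- The dual of a word over `{!,?} × A`: swap `!` and `?` pointwise. -/
def dualWord {A : Type} (w : List (Pol × A)) : List (Pol × A) :=
  w.map fun x => (x.1.dual, x.2)

/-- Universal state type: base states from `B`, plus arbitrarily nested fresh
"hat" states (one for each transition) used by the gateway construction. -/
inductive St (R A B : Type) : Type
  | base : B → St R A B
  | hat : St R A B → Act R A → St R A B → St R A B

/-- A communicating finite state machine over roles `R` and messages `A`,
with states taken from `St R A B`: an initial state together with a
transition relation. -/
structure CFSM (R A B : Type) where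
  init : St R A B
  delta : Set (St R A B × Act R A × St R A B)

namespace CFSM

variable {R A B : Type}

/-- A state is final if it has no outgoing transition. -/
def Final (M : CFSM R A B) (q : St R A B) : Prop :=
  ∀ l q', (q, l, q') ∉ M.delta

/-- A sending state: non-final, and all outgoing transitions are sends. -/
def Sending (M : CFSM R A B) (q : St R A B) : Prop :=
  (∃ l q', (q, l, q') ∈ M.delta) ∧ ∀ l q', (q, l, q') ∈ M.delta → l.isSend

/-- A receiving state: non-final, and all outgoing transitions are receives. -/
def Receiving (M : CFSM R A B) (q : St R A B) : Prop :=
  (∃ l q', (q, l, q') ∈ M.delta) ∧ ∀ l q', (q, l, q') ∈ M.delta → l.isRecv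

/-- A mixed state: it has both an outgoing send and an outgoing receive. -/
def Mixed (M : CFSM R A B) (q : St R A B) : Prop :=
  (∃ l q', (q, l, q') ∈ M.delta ∧ l.isSend) ∧
  (∃ l q', (q, l, q') ∈ M.delta ∧ l.isRecv)

/-- `M` has no mixed states. -/
def NoMixed (M : CFSM R A B) : Prop := ∀ q, ¬ M.Mixed q

/-- `?`-determinism: two receives of the same message from the same state
(possibly on different channels) have the same target. -/
def QDet (M : CFSM R A B) : Prop :=
  ∀ q a s r s' r' q' q'', (q, Act.rcv s r a, q') ∈ M.delta →
    (q, Act.rcv s' r' a, q'') ∈ M.delta → q' = q''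

/-- `!`-determinism: two sends of the same message from the same state
(possibly on different channels) have the same target. -/
def BDet (M : CFSM R A B) : Prop :=
  ∀ q a s r s' r' q' q'', (q, Act.snd s r a, q') ∈ M.delta →
    (q, Act.snd s' r' a, q'') ∈ M.delta → q' = q''

/-- `?!`-determinism. -/
def IODet (M : CFSM R A B) : Prop := M.QDet ∧ M.BDet

/-- Accepting runs from a given state (every state is accepting). -/
inductive Accepts (M : CFSM R A B) : St R A B → List (Act R A) → Prop
  | nil (q : St R A B) : Accepts M q []
  | cons {q : St R A B} {l : Act R A} {q' : St R A B} {φ : List (Act R A)} :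
      (q, l, q') ∈ M.delta → Accepts M q' φ → Accepts M q (l :: φ)

/-- The language of `M` over `Act`. -/
def lang (M : CFSM R A B) : Set (List (Act R A)) := {φ | M.Accepts M.init φ}

/-- The language of `M` with channel names erased. -/
def langNoC (M : CFSM R A B) : Set (List (Pol × A)) :=
  (fun φ => φ.map Act.noC) '' M.lang

/-- Compatibility `M ↔ M'`: the channel-erased language of `M` is the set of
duals of the channel-erased language of `M'`; moreover neither machine has a
mixed state and both are `?!`-deterministic. -/
def Compat (M M' : CFSM R A B) : Prop :=
  M.langNoC = dualWord '' M'.langNoC ∧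
  M.NoMixed ∧ M'.NoMixed ∧ M.IODet ∧ M'.IODet

/-- The machine of role `p` over the role set `P`: every transition label is
an action of `p` (a send `pr!a` or a receive `rp?a`) with partner `r ∈ P`. -/
def ActsFor (M : CFSM R A B) (p : R) (P : Set R) : Prop :=
  ∀ q l q', (q, l, q') ∈ M.delta →
    ∃ r a, r ∈ P ∧ r ≠ p ∧ (l = Act.snd p r a ∨ l = Act.rcv r p a)

/-- All states occurring in `M` are base states; this guarantees that the
intermediate "hat" states of the gateway construction are fresh for `M`. -/
def HatFree (M : CFSM R A B) : Prop :=
  (∃ b, M.init = St.base b) ∧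
  ∀ q l q', (q, l, q') ∈ M.delta →
    (∃ b, q = St.base b) ∧ (∃ b, q' = St.base b)

/-- The set `Q̂` of fresh intermediate gateway states of `M`
(one for each transition of `M`). -/
def hatStates (M : CFSM R A B) : Set (St R A B) :=
  {x | ∃ q l q', (q, l, q') ∈ M.delta ∧ x = St.hat q l q'}

/-- The gateway `gw(M_H, K)` of the machine `M` of role `H` towards role `K`:
each transition `t = (q, Hs!a, q')` of `M` is replaced by
`(q, KH?a, q̂_t)` and `(q̂_t, Hs!a, q')`, and each transition
`t = (q, sH?a, q')` of `M` is replaced by `(q, sH?a, q̂_t)` and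
`(q̂_t, HK!a, q')`. -/
def gw (M : CFSM R A B) (H K : R) : CFSM R A B where
  init := M.init
  delta :=
    {x | ∃ q s a q', (q, Act.snd H s a, q') ∈ M.delta ∧
      (x = (q, Act.rcv K H a, St.hat q (Act.snd H s a) q') ∨
       x = (St.hat q (Act.snd H s a) q', Act.snd H s a, q'))} ∪
    {x | ∃ q s a q', (q, Act.rcv s H a, q') ∈ M.delta ∧
      (x = (q, Act.rcv s H a, St.hat q (Act.rcv s H a) q') ∨
       x = (St.hat q (Act.rcv s H a) q', Act.snd H K a, q'))}

end CFSM

/-- A communicating system: a set of roles together with a CFSM for each role. -/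
structure CS (R A B : Type) where
  roles : Set R
  mach : R → CFSM R A B

namespace CS

variable {R A B : Type}

/-- Well-formedness: the machine of each role `p` of the system only carries
actions of `p` with partners among the system's roles. -/
def WF (S : CS R A B) : Prop :=
  ∀ p ∈ S.roles, (S.mach p).ActsFor p S.roles

/-- Each machine of the system has a finite transition relation
(hence finitely many relevant states). -/
def FiniteSys (S : CS R A B) : Prop :=
  ∀ p ∈ S.roles, (S.mach p).delta.Finite

open scoped Classical in
/-- Composition `S1 ⋈_{H,K} S2`: the union of the two systems, where the
machines of the interface roles `H` and `K` are replaced by the gateways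
`gw(M¹_H, K)` and `gw(M²_K, H)`. -/
noncomputable def compose (S1 S2 : CS R A B) (H K : R) : CS R A B where
  roles := S1.roles ∪ S2.roles
  mach := fun p =>
    if p = H then (S1.mach H).gw H K
    else if p = K then (S2.mach K).gw K H
    else if p ∈ S1.roles then S1.mach p
    else S2.mach p

end CS

/-- A configuration: a local state for every role and a buffer (word over the
messages) for every ordered channel. -/
structure Config (R A B : Type) where
  st : R → St R A B
  buf : R → R → List A

/-- The initial configuration(s) of a system: every machine of the system is
in its initial state and all the system's buffers are empty. -/
def InitConf {R A B : Type} (S : CS R A B) (c : Config R A B) : Prop :=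
  (∀ p ∈ S.roles, c.st p = (S.mach p).init) ∧
  (∀ p ∈ S.roles, ∀ q ∈ S.roles, c.buf p q = [])

/-- One asynchronous step of system `S`, labelled by an action:
a send `sr!a` appends `a` to the buffer of channel `sr`, a receive `sr?a`
removes `a` from the front of the buffer of channel `sr`; everything else is
unchanged. -/
def Step {R A B : Type} (S : CS R A B) (c : Config R A B) :
    Act R A → Config R A B → Prop
  | .snd s r a, c' =>
      s ∈ S.roles ∧ (c.st s, Act.snd s r a, c'.st s) ∈ (S.mach s).delta ∧
      (∀ p, p ≠ s → c'.st p = c.st p) ∧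
      c'.buf s r = c.buf s r ++ [a] ∧
      (∀ p q, ¬(p = s ∧ q = r) → c'.buf p q = c.buf p q)
  | .rcv s r a, c' =>
      r ∈ S.roles ∧ (c.st r, Act.rcv s r a, c'.st r) ∈ (S.mach r).delta ∧
      (∀ p, p ≠ r → c'.st p = c.st p) ∧
      c.buf s r = a :: c'.buf s r ∧
      (∀ p q, ¬(p = s ∧ q = r) → c'.buf p q = c.buf p q)

/-- `RS(S)`: the configurations reachable from the initial configuration. -/
def Reach {R A B : Type} (S : CS R A B) (c : Config R A B) : Prop :=
  ∃ c₀, InitConf S c₀ ∧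
    Relation.ReflTransGen (fun x y => ∃ l, Step S x l y) c₀ c

/-- Deadlock configuration: all the system's buffers are empty and every
machine is in a receiving state. -/
def DeadlockConf {R A B : Type} (S : CS R A B) (c : Config R A B) : Prop :=
  (∀ p ∈ S.roles, ∀ q ∈ S.roles, c.buf p q = []) ∧
  ∀ p ∈ S.roles, (S.mach p).Receiving (c.st p)

/-- A system is deadlock-free if no reachable configuration is a deadlock. -/
def DeadlockFree {R A B : Type} (S : CS R A B) : Prop :=
  ∀ c, Reach S c → ¬ DeadlockConf S c

/-- Orphan-message configuration: every machine is in a final state but some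
buffer of the system is non-empty. -/
def OrphanConf {R A B : Type} (S : CS R A B) (c : Config R A B) : Prop :=
  (∀ p ∈ S.roles, (S.mach p).Final (c.st p)) ∧
  ∃ p ∈ S.roles, ∃ q ∈ S.roles, c.buf p q ≠ []

/-- Unspecified reception configuration: some machine is in a receiving state
but each of its expected input buffers is non-empty and starts with a message
it cannot receive. -/
def UnspecConf {R A B : Type} (S : CS R A B) (c : Config R A B) : Prop :=
  ∃ r ∈ S.roles, (S.mach r).Receiving (c.st r) ∧
    ∀ s a q', (c.st r, Act.rcv s r a, q') ∈ (S.mach r).delta →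
      c.buf s r ≠ [] ∧ ∀ w, c.buf s r ≠ a :: w

/-- A system is safe if no reachable configuration is a deadlock,
an orphan-message, or an unspecified reception configuration. -/
def Safe {R A B : Type} (S : CS R A B) : Prop :=
  ∀ c, Reach S c →
    ¬ DeadlockConf S c ∧ ¬ OrphanConf S c ∧ ¬ UnspecConf S c

end GTIR

open GTIR

namespace GTIR

variable {R A B : Type}

structure IsComp (S S1 S2 : CS R A B) (H K : R) : Prop where
  hH : H ∈ S1.roles
  hK : K ∈ S2.roles
  dis : ∀ p, p ∈ S1.roles → p ∈ S2.roles → False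
  roles : ∀ p, p ∈ S.roles ↔ (p ∈ S1.roles ∨ p ∈ S2.roles)
  mH : S.mach H = (S1.mach H).gw H K
  mK : S.mach K = (S2.mach K).gw K H
  m1 : ∀ p ∈ S1.roles, p ≠ H → S.mach p = S1.mach p
  m2 : ∀ p ∈ S2.roles, p ≠ K → S.mach p = S2.mach p
  wf1 : S1.WF
  wf2 : S2.WF
  hf1 : (S1.mach H).HatFree
  hf2 : (S2.mach K).HatFree
  nm1 : (S1.mach H).NoMixed
  nm2 : (S2.mach K).NoMixed
  d1 : (S1.mach H).IODet
  d2 : (S2.mach K).IODet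

theorem IsComp.symm {S S1 S2 : CS R A B} {H K : R} (h : IsComp S S1 S2 H K) :
    IsComp S S2 S1 K H where
  hH := h.hK
  hK := h.hH
  dis := fun p a b => h.dis p b a
  roles := fun p => (h.roles p).trans or_comm
  mH := h.mK
  mK := h.mH
  m1 := h.m2
  m2 := h.m1
  wf1 := h.wf2
  wf2 := h.wf1
  hf1 := h.hf2
  hf2 := h.hf1
  nm1 := h.nm2
  nm2 := h.nm1
  d1 := h.d2
  d2 := h.d1

def pr : St R A B → St R A B
  | .base b => .base b
  | .hat q (.snd _ _ _) _ => q
  | .hat _ (.rcv _ _ _) q' => q'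

def sg : St R A B → St R A B
  | .base b => .base b
  | .hat _ _ q' => q'

def pend : St R A B → List A
  | .hat _ (.rcv _ _ a) _ => [a]
  | _ => []

theorem reach_snd {S : CS R A B} {c : Config R A B} (hc : Reach S c) {s r : R} {a : A}
    {q' : St R A B} (hs : s ∈ S.roles) (hd : (c.st s, Act.snd s r a, q') ∈ (S.mach s).delta) :
    ∃ c', Reach S c' ∧ c'.st s = q' ∧ (∀ p, p ≠ s → c'.st p = c.st p) ∧
      c'.buf s r = c.buf s r ++ [a] ∧
      (∀ p q, ¬(p = s ∧ q = r) → c'.buf p q = c.buf p q) := by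
  classical
  let c' : Config R A B := ⟨Function.update c.st s q',
    fun x y => if x = s ∧ y = r then c.buf s r ++ [a] else c.buf x y⟩
  have e1 : c'.st s = q' := by simp [c']
  have e2 : ∀ p, p ≠ s → c'.st p = c.st p := by intro p hp; simp [c', hp]
  have e3 : c'.buf s r = c.buf s r ++ [a] := by simp [c']
  have e4 : ∀ p q, ¬(p = s ∧ q = r) → c'.buf p q = c.buf p q := by
    intro p q h; simp only [c', if_neg h]
  obtain ⟨c0, h0, h1⟩ := hc
  exact ⟨c', ⟨c0, h0, h1.tail ⟨Act.snd s r a, hs, by rw [e1]; exact hd, e2, e3, e4⟩⟩, e1, e2, e3, e4⟩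

theorem reach_rcv {S : CS R A B} {c : Config R A B} (hc : Reach S c) {s r : R} {a : A}
    {q' : St R A B} {w : List A} (hs : r ∈ S.roles)
    (hd : (c.st r, Act.rcv s r a, q') ∈ (S.mach r).delta) (hb : c.buf s r = a :: w) :
    ∃ c', Reach S c' ∧ c'.st r = q' ∧ (∀ p, p ≠ r → c'.st p = c.st p) ∧
      c'.buf s r = w ∧
      (∀ p q, ¬(p = s ∧ q = r) → c'.buf p q = c.buf p q) := by
  classical
  let c' : Config R A B := ⟨Function.update c.st r q',
    fun x y => if x = s ∧ y = r then w else c.buf x y⟩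
  have e1 : c'.st r = q' := by simp [c']
  have e2 : ∀ p, p ≠ r → c'.st p = c.st p := by intro p hp; simp [c', hp]
  have e3 : c'.buf s r = w := by simp [c']
  have e4 : ∀ p q, ¬(p = s ∧ q = r) → c'.buf p q = c.buf p q := by
    intro p q h; simp only [c', if_neg h]
  obtain ⟨c0, h0, h1⟩ := hc
  exact ⟨c', ⟨c0, h0, h1.tail ⟨Act.rcv s r a, hs, by rw [e1]; exact hd, e2, by rw [e3, hb], e4⟩⟩,
    e1, e2, e3, e4⟩

def Proj (S1 : CS R A B) (H : R) (c : Config R A B) : Prop :=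
  ∃ c1, Reach S1 c1 ∧ (∀ p ∈ S1.roles, p ≠ H → c1.st p = c.st p) ∧
    c1.st H = pr (c.st H) ∧ ∀ p ∈ S1.roles, ∀ q ∈ S1.roles, c1.buf p q = c.buf p q

theorem pr_of_src {M : CFSM R A B} (h : M.HatFree) {q l q'} (hd : (q, l, q') ∈ M.delta) :
    pr q = q ∧ pr q' = q' ∧ sg q = q ∧ sg q' = q' ∧ pend q = [] ∧ pend q' = [] := by
  obtain ⟨⟨b, rfl⟩, ⟨b', rfl⟩⟩ := h.2 _ _ _ hd
  simp [pr, sg, pend]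

theorem wf_snd {S : CS R A B} (h : S.WF) {p : R} (hp : p ∈ S.roles) {q s r a q'}
    (hd : (q, Act.snd s r a, q') ∈ (S.mach p).delta) : s = p ∧ r ∈ S.roles ∧ r ≠ p := by
  obtain ⟨r', a', h1, h2, h3 | h3⟩ := h p hp _ _ _ hd
  · cases h3; exact ⟨rfl, h1, h2⟩
  · cases h3

theorem wf_rcv {S : CS R A B} (h : S.WF) {p : R} (hp : p ∈ S.roles) {q s r a q'}
    (hd : (q, Act.rcv s r a, q') ∈ (S.mach p).delta) : r = p ∧ s ∈ S.roles ∧ s ≠ p := by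
  obtain ⟨r', a', h1, h2, h3 | h3⟩ := h p hp _ _ _ hd
  · cases h3
  · cases h3; exact ⟨rfl, h1, h2⟩

/-- A step of the gateway. -/
theorem gw_snd {M : CFSM R A B} {H K r : R} {a : A} {x y : St R A B}
    (h : (x, Act.snd H r a, y) ∈ (M.gw H K).delta) :
    (∃ q, x = St.hat q (Act.snd H r a) y ∧ (q, Act.snd H r a, y) ∈ M.delta) ∨
    (r = K ∧ ∃ q s, x = St.hat q (Act.rcv s H a) y ∧ (q, Act.rcv s H a, y) ∈ M.delta) := by
  rcases h with ⟨q, s, a', q', hd, h | h⟩ | ⟨q, s, a', q', hd, h | h⟩ <;> cases h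
  · exact Or.inl ⟨q, rfl, hd⟩
  · exact Or.inr ⟨rfl, q, s, rfl, hd⟩

theorem gw_rcv {M : CFSM R A B} {H K s : R} {a : A} {x y : St R A B}
    (h : (x, Act.rcv s H a, y) ∈ (M.gw H K).delta) :
    (s = K ∧ ∃ r q', y = St.hat x (Act.snd H r a) q' ∧ (x, Act.snd H r a, q') ∈ M.delta) ∨
    (∃ q', y = St.hat x (Act.rcv s H a) q' ∧ (x, Act.rcv s H a, q') ∈ M.delta) := by
  rcases h with ⟨q, s, a', q', hd, h | h⟩ | ⟨q, s, a', q', hd, h | h⟩ <;> cases h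
  · exact Or.inl ⟨rfl, s, q', rfl, hd⟩
  · exact Or.inr ⟨q', rfl, hd⟩

theorem proj_step {S S1 S2 : CS R A B} {H K : R} (I : IsComp S S1 S2 H K)
    {c c' : Config R A B} {l : Act R A} (hs : Step S c l c') (hp : Proj S1 H c) :
    Proj S1 H c' := by
  obtain ⟨c1, hr, e1, e2, e3⟩ := hp
  have hK1 : K ∉ S1.roles := fun h => I.dis K h I.hK
  cases l with
  | snd s r a =>
    obtain ⟨hsr, hd, f1, f2, f3⟩ := hs
    by_cases h1 : s ∈ S1.roles
    swap
    · refine ⟨c1, hr, ?_, ?_, ?_⟩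
      · intro p hp hpH; rw [e1 p hp hpH, f1]; rintro rfl; exact h1 hp
      · rw [e2, f1]; rintro rfl; exact h1 I.hH
      · intro p hp q hq; rw [e3 p hp q hq, f3]; rintro ⟨rfl, -⟩; exact h1 hp
    by_cases hH : s = H
    · subst hH
      rw [I.mH] at hd
      rcases gw_snd hd with ⟨q, hx, hm⟩ | ⟨rfl, q, s', hx, hm⟩
      · have hps := pr_of_src I.hf1 hm
        have e2' : c1.st s = q := by rw [e2, hx]; rfl
        obtain ⟨c1', r1, g1, g2, g3, g4⟩ := reach_snd hr h1 (by rw [e2']; exact hm)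
        refine ⟨c1', r1, ?_, ?_, ?_⟩
        · intro p hp hpH; rw [g2 p hpH, f1 p hpH, e1 p hp hpH]
        · rw [g1, hps.2.1]
        · intro p hp q hq
          by_cases h : p = s ∧ q = r
          · obtain ⟨rfl, rfl⟩ := h; rw [g3, f2, e3 _ hp _ hq]
          · rw [g4 _ _ h, f3 _ _ h, e3 _ hp _ hq]
      · have hps := pr_of_src I.hf1 hm
        refine ⟨c1, hr, ?_, ?_, ?_⟩
        · intro p hp hpH; rw [f1 p hpH, e1 p hp hpH]
        · rw [e2, hx, hps.2.1]; rfl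
        · intro p hp q hq
          rw [e3 p hp q hq, f3]; rintro ⟨-, rfl⟩; exact hK1 hq
    · rw [I.m1 s h1 hH, ← e1 s h1 hH] at hd
      obtain ⟨c1', r1, g1, g2, g3, g4⟩ := reach_snd hr h1 hd
      refine ⟨c1', r1, ?_, ?_, ?_⟩
      · intro p hp hpH
        by_cases h : p = s
        · rw [h, g1]
        · rw [g2 p h, f1 p h, e1 p hp hpH]
      · rw [g2 _ (Ne.symm hH), f1 _ (Ne.symm hH), e2]
      · intro p hp q hq
        by_cases h : p = s ∧ q = r
        · obtain ⟨rfl, rfl⟩ := h; rw [g3, f2, e3 _ hp _ hq]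
        · rw [g4 _ _ h, f3 _ _ h, e3 _ hp _ hq]
  | rcv s r a =>
    obtain ⟨hsr, hd, f1, f2, f3⟩ := hs
    by_cases h1 : r ∈ S1.roles
    swap
    · refine ⟨c1, hr, ?_, ?_, ?_⟩
      · intro p hp hpH; rw [e1 p hp hpH, f1]; rintro rfl; exact h1 hp
      · rw [e2, f1]; rintro rfl; exact h1 I.hH
      · intro p hp q hq; rw [e3 p hp q hq, f3]; rintro ⟨-, rfl⟩; exact h1 hq
    by_cases hH : r = H
    · subst hH
      rw [I.mH] at hd
      rcases gw_rcv hd with ⟨rfl, r', q', hx, hm⟩ | ⟨q', hx, hm⟩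
      · have hps := pr_of_src I.hf1 hm
        refine ⟨c1, hr, ?_, ?_, ?_⟩
        · intro p hp hpH; rw [f1 p hpH, e1 p hp hpH]
        · rw [e2, hx, hps.1]; rfl
        · intro p hp q hq
          rw [e3 p hp q hq, f3]; rintro ⟨rfl, -⟩; exact hK1 hp
      · have hps := pr_of_src I.hf1 hm
        have hw := wf_rcv I.wf1 h1 hm
        have e2' : c1.st r = c.st r := by rw [e2, hps.1]
        obtain ⟨c1', r1, g1, g2, g3, g4⟩ := reach_rcv hr h1 (by rw [e2']; exact hm)
          (by rw [e3 _ hw.2.1 _ h1]; exact f2)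
        refine ⟨c1', r1, ?_, ?_, ?_⟩
        · intro p hp hpH; rw [g2 p hpH, f1 p hpH, e1 p hp hpH]
        · rw [g1, hx]; rfl
        · intro p hp q hq
          by_cases h : p = s ∧ q = r
          · obtain ⟨rfl, rfl⟩ := h; rw [g3]
          · rw [g4 _ _ h, f3 _ _ h, e3 _ hp _ hq]
    · rw [I.m1 r h1 hH, ← e1 r h1 hH] at hd
      have hw := wf_rcv I.wf1 h1 hd
      obtain ⟨c1', r1, g1, g2, g3, g4⟩ := reach_rcv hr h1 hd
          (by rw [e3 _ hw.2.1 _ h1]; exact f2)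
      refine ⟨c1', r1, ?_, ?_, ?_⟩
      · intro p hp hpH
        by_cases h : p = r
        · rw [h, g1]
        · rw [g2 p h, f1 p h, e1 p hp hpH]
      · rw [g2 _ (Ne.symm hH), f1 _ (Ne.symm hH), e2]
      · intro p hp q hq
        by_cases h : p = s ∧ q = r
        · obtain ⟨rfl, rfl⟩ := h; rw [g3]
        · rw [g4 _ _ h, f3 _ _ h, e3 _ hp _ hq]

theorem proj_init {S S1 S2 : CS R A B} {H K : R} (I : IsComp S S1 S2 H K)
    {c : Config R A B} (h : InitConf S c) : Proj S1 H c := by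
  have i : (S1.mach H).init = pr (S1.mach H).init := by
    obtain ⟨b, hb⟩ := I.hf1.1
    rw [hb]; rfl
  have hHst : c.st H = (S1.mach H).init := by
    rw [h.1 H ((I.roles H).2 (Or.inl I.hH)), I.mH]; rfl
  refine ⟨c, ⟨c, ⟨?_, ?_⟩, .refl⟩, fun _ _ _ => rfl, ?_, fun _ _ _ _ => rfl⟩
  · intro p hp
    by_cases hH : p = H
    · subst hH; exact hHst
    · rw [h.1 p ((I.roles p).2 (Or.inl hp)), I.m1 p hp hH]
  · intro p hp q hq
    exact h.2 p ((I.roles p).2 (Or.inl hp)) q ((I.roles q).2 (Or.inl hq))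
  · rw [hHst]; exact i

/-! Duality -/

def Dual (M N : CFSM R A B) (q q' : St R A B) : Prop :=
  ∀ w, (∃ φ, M.Accepts q φ ∧ φ.map Act.noC = w) ↔
    (∃ φ, N.Accepts q' φ ∧ φ.map Act.noC = dualWord w)

theorem dualWord_dualWord (w : List (Pol × A)) : dualWord (dualWord w) = w := by
  unfold dualWord
  rw [List.map_map]
  conv_rhs => rw [← List.map_id w]
  congr 1
  funext ⟨p, a⟩
  cases p <;> rfl

theorem Dual.symm {M N : CFSM R A B} {q q'} (h : Dual M N q q') : Dual N M q' q := by
  intro w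
  have := h (dualWord w)
  rw [dualWord_dualWord] at this
  exact this.symm

theorem noC_snd {l : Act R A} {a : A} (h : l.noC = (.bang, a)) : ∃ s r, l = .snd s r a := by
  cases l <;> simp [Act.noC] at h
  subst h; exact ⟨_, _, rfl⟩

theorem noC_rcv {l : Act R A} {a : A} (h : l.noC = (.query, a)) : ∃ s r, l = .rcv s r a := by
  cases l <;> simp [Act.noC] at h
  subst h; exact ⟨_, _, rfl⟩

theorem accepts_cons {M : CFSM R A B} {q l φ} (h : M.Accepts q (l :: φ)) :
    ∃ q', (q, l, q') ∈ M.delta ∧ M.Accepts q' φ := by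
  cases h with
  | cons h1 h2 => exact ⟨_, h1, h2⟩

/-- If `q` receives `a`, the dual state sends `a`. -/
theorem Dual.step {M N : CFSM R A B} (hM : M.IODet) (hN : N.IODet) {q q'} (h : Dual M N q q')
    {s r a q1} (hd : (q, Act.rcv s r a, q1) ∈ M.delta) :
    ∃ s' r' q1', (q', Act.snd s' r' a, q1') ∈ N.delta ∧ Dual M N q1 q1' := by
  obtain ⟨φ, hφ, e⟩ := (h [(.query, a)]).1 ⟨[Act.rcv s r a], .cons hd (.nil _), rfl⟩
  cases φ with
  | nil => simp [dualWord] at e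
  | cons l φ =>
    simp [dualWord, Pol.dual] at e
    obtain ⟨s', r', rfl⟩ := noC_snd e.1
    obtain ⟨q1', hd', -⟩ := accepts_cons hφ
    refine ⟨s', r', q1', hd', fun w => ?_⟩
    constructor
    · rintro ⟨φ, h1, h2⟩
      obtain ⟨ψ, g1, g2⟩ := (h ((.query, a) :: w)).1 ⟨_, .cons hd h1, by rw [List.map_cons, h2]; rfl⟩
      cases ψ with
      | nil => simp [dualWord] at g2
      | cons l ψ =>
        simp only [dualWord, List.map_cons, Pol.dual, List.cons.injEq] at g2
        obtain ⟨s2, r2, rfl⟩ := noC_snd g2.1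
        obtain ⟨q2, hd2, hac⟩ := accepts_cons g1
        rw [hN.2 _ _ _ _ _ _ _ _ hd' hd2]
        exact ⟨ψ, hac, g2.2⟩
    · rintro ⟨φ, h1, h2⟩
      obtain ⟨ψ, g1, g2⟩ := (h ((.query, a) :: w)).2 ⟨_, .cons hd' h1, by rw [List.map_cons, h2]; rfl⟩
      cases ψ with
      | nil => simp at g2
      | cons l ψ =>
        simp only [List.map_cons, List.cons.injEq] at g2
        obtain ⟨s2, r2, rfl⟩ := noC_rcv g2.1
        obtain ⟨q2, hd2, hac⟩ := accepts_cons g1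
        rw [hM.1 _ _ _ _ _ _ _ _ hd hd2]
        exact ⟨ψ, hac, g2.2⟩

inductive SendRun (M : CFSM R A B) : St R A B → List A → St R A B → Prop
  | nil (q) : SendRun M q [] q
  | cons {q s r a q1 w q2} : (q, Act.snd s r a, q1) ∈ M.delta → SendRun M q1 w q2 →
      SendRun M q (a :: w) q2

theorem SendRun.snoc {M : CFSM R A B} {q w q1} (h : SendRun M q w q1) {s r a q2}
    (hd : (q1, Act.snd s r a, q2) ∈ M.delta) : SendRun M q (w ++ [a]) q2 := by
  induction h with
  | nil q => exact .cons hd (.nil _)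
  | cons h1 _ ih => exact .cons h1 (ih hd)

theorem sendRun_cons {M : CFSM R A B} {q a w q2} (h : SendRun M q (a :: w) q2) :
    ∃ s r q1, (q, Act.snd s r a, q1) ∈ M.delta ∧ SendRun M q1 w q2 := by
  cases h with
  | cons h1 h2 => exact ⟨_, _, _, h1, h2⟩

theorem sendRun_nil {M : CFSM R A B} {q q2} (h : SendRun M q [] q2) : q2 = q := by
  cases h; rfl

/-- State-level invariant: (state of H, word H→K, state of K, word K→H). -/
def Inv0 (M N : CFSM R A B) (x : St R A B) (u : List A) (y : St R A B) (v : List A) : Prop :=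
  (v = [] ∧ ∃ z, SendRun N y u z ∧ Dual M N x z) ∨
  (u = [] ∧ ∃ z, SendRun M x v z ∧ Dual N M y z)

def Inv (S1 S2 : CS R A B) (H K : R) (c : Config R A B) : Prop :=
  Inv0 (S1.mach H) (S2.mach K) (sg (c.st H)) (c.buf H K ++ pend (c.st H))
    (sg (c.st K)) (c.buf K H ++ pend (c.st K))

theorem Inv.symm {S1 S2 : CS R A B} {H K : R} {c : Config R A B} (h : Inv S1 S2 H K c) :
    Inv S2 S1 K H c := Or.symm h

theorem inv_step {S S1 S2 : CS R A B} {H K : R} (I : IsComp S S1 S2 H K)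
    {c c' : Config R A B} {l : Act R A} (hs : Step S c l c') (hp : Inv S1 S2 H K c)
    (hl : ∀ s r a, (l = .snd s r a → s ∈ S1.roles) ∧ (l = .rcv s r a → r ∈ S1.roles)) :
    Inv S1 S2 H K c' := by
  have hK1 : K ∉ S1.roles := fun h => I.dis K h I.hK
  have hHK : H ≠ K := by rintro rfl; exact hK1 I.hH
  unfold Inv at hp ⊢
  cases l with
  | snd s r a =>
    obtain ⟨hsr, hd, f1, f2, f3⟩ := hs
    have h1 := (hl s r a).1 rfl
    have hsK : K ≠ s := by rintro rfl; exact hK1 h1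
    have eK : c'.st K = c.st K := f1 K hsK
    have eKH : c'.buf K H = c.buf K H := f3 _ _ (fun h => hsK h.1)
    rw [eK, eKH]
    by_cases hH : s = H
    · subst hH
      rw [I.mH] at hd
      rcases gw_snd hd with ⟨q, hx, hm⟩ | ⟨rfl, q, s', hx, hm⟩
      · have hps := pr_of_src I.hf1 hm
        have hw := wf_snd I.wf1 h1 hm
        rw [f3 s K (by rintro ⟨-, rfl⟩; exact hK1 hw.2.1), hps.2.2.2.1, hps.2.2.2.2.2]
        rw [hx] at hp
        exact hp
      · have hps := pr_of_src I.hf1 hm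
        rw [f2, hps.2.2.2.1, hps.2.2.2.2.2, List.append_nil]
        rw [hx] at hp
        exact hp
    · rw [f1 H (Ne.symm hH), f3 H K (fun h => hH h.1.symm)]
      exact hp
  | rcv s r a =>
    obtain ⟨hsr, hd, f1, f2, f3⟩ := hs
    have h1 := (hl s r a).2 rfl
    have hsK : K ≠ r := by rintro rfl; exact hK1 h1
    have eK : c'.st K = c.st K := f1 K hsK
    have eHK : c'.buf H K = c.buf H K := f3 _ _ (fun h => hsK h.2)
    rw [eK, eHK]
    by_cases hH : r = H
    · subst hH
      rw [I.mH] at hd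
      rcases gw_rcv hd with ⟨rfl, r', q', hx, hm⟩ | ⟨q', hx, hm⟩
      · have hps := pr_of_src I.hf1 hm
        rw [hps.2.2.1, hps.2.2.2.2.1, f2] at hp
        rw [hx]
        rcases hp with ⟨h, -⟩ | ⟨hu, z, hz, hD⟩
        · simp at h
        · obtain ⟨s2, r2, q1, hd2, hz'⟩ := sendRun_cons hz
          rw [← I.d1.2 _ _ _ _ _ _ _ _ hm hd2] at hz'
          exact Or.inr ⟨hu, z, hz', hD⟩
      · have hps := pr_of_src I.hf1 hm
        have hw := wf_rcv I.wf1 h1 hm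
        rw [hps.2.2.1, hps.2.2.2.2.1, List.append_nil] at hp
        rw [hx, f3 K r (by rintro ⟨rfl, -⟩; exact hK1 hw.2.1)]
        have key : c.buf K r ++ pend (c.st K) = [] ∧
            ∃ z, SendRun (S2.mach K) (sg (c.st K)) (c.buf r K) z ∧
              Dual (S1.mach r) (S2.mach K) (c.st r) z := by
          rcases hp with h | ⟨hu, z, hz, hD⟩
          · exact h
          · rcases hv : c.buf K r ++ pend (c.st K) with _ | ⟨b, v⟩
            · rw [hv] at hz
              rw [sendRun_nil hz] at hD
              refine ⟨rfl, _, ?_, hD.symm⟩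
              rw [hu]; exact .nil _
            · rw [hv] at hz
              obtain ⟨s2, r2, q1, hd2, hz'⟩ := sendRun_cons hz
              exact absurd ⟨⟨_, _, hd2, trivial⟩, ⟨_, _, hm, trivial⟩⟩ (I.nm1 (c.st r))
        obtain ⟨hv, z, hz, hD⟩ := key
        obtain ⟨s2, r2, z', hd2, hD'⟩ := hD.step I.d1 I.d2 hm
        exact Or.inl ⟨hv, z', hz.snoc hd2, hD'⟩
    · rw [f1 H (Ne.symm hH), f3 K H (fun h => hH h.2.symm)]
      exact hp

theorem inv_step' {S S1 S2 : CS R A B} {H K : R} (I : IsComp S S1 S2 H K)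
    {c c' : Config R A B} {l : Act R A} (hs : Step S c l c') (hp : Inv S1 S2 H K c) :
    Inv S1 S2 H K c' := by
  have : (∀ s r a, (l = .snd s r a → s ∈ S1.roles) ∧ (l = .rcv s r a → r ∈ S1.roles)) ∨
      (∀ s r a, (l = .snd s r a → s ∈ S2.roles) ∧ (l = .rcv s r a → r ∈ S2.roles)) := by
    cases l with
    | snd s r a =>
      rcases (I.roles s).1 hs.1 with h | h
      · left; intro s' r' a'; exact ⟨fun e => by cases e; exact h, fun e => by cases e⟩
      · right; intro s' r' a'; exact ⟨fun e => by cases e; exact h, fun e => by cases e⟩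
    | rcv s r a =>
      rcases (I.roles r).1 hs.1 with h | h
      · left; intro s' r' a'; exact ⟨fun e => (by cases e), fun e => (by cases e; exact h)⟩
      · right; intro s' r' a'; exact ⟨fun e => (by cases e), fun e => (by cases e; exact h)⟩
  rcases this with h | h
  · exact inv_step I hs hp h
  · exact (inv_step I.symm hs hp.symm h).symm

theorem no_unspec {S S1 S2 : CS R A B} {H K : R} (I : IsComp S S1 S2 H K)
    (hu : ∀ c, Reach S1 c → ¬ UnspecConf S1 c) {c : Config R A B}
    (hp : Proj S1 H c) (hi : Inv S1 S2 H K c) {r : R} (hr : r ∈ S1.roles)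
    (hrec : (S.mach r).Receiving (c.st r))
    (hb : ∀ s a q', (c.st r, Act.rcv s r a, q') ∈ (S.mach r).delta →
      c.buf s r ≠ [] ∧ ∀ w, c.buf s r ≠ a :: w) : False := by
  obtain ⟨c1, hr1, e1, e2, e3⟩ := hp
  by_cases hH : r = H
  · subst hH
    rw [I.mH] at hrec hb
    by_cases hsend : ∃ s a q', (c.st r, Act.snd r s a, q') ∈ (S1.mach r).delta
    · obtain ⟨s, a, q', hd⟩ := hsend
      have hps := pr_of_src I.hf1 hd
      have hne := (hb K a _ (Or.inl ⟨_, s, a, q', hd, Or.inl rfl⟩)).1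
      unfold Inv at hi
      rw [hps.2.2.1] at hi
      obtain ⟨b, w, hbw⟩ := List.exists_cons_of_ne_nil hne
      rw [hbw] at hi
      rcases hi with ⟨h, -⟩ | ⟨-, z, hz, -⟩
      · simp at h
      · obtain ⟨s2, r2, q1, hd2, -⟩ := sendRun_cons hz
        obtain ⟨rfl, -⟩ := wf_snd I.wf1 hr hd2
        exact (hb K b _ (Or.inl ⟨_, r2, b, q1, hd2, Or.inl rfl⟩)).2 w hbw
    · have hall : ∀ l q', (c.st r, l, q') ∈ (S1.mach r).delta → l.isRecv := by
        intro l q' hd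
        cases l with
        | rcv => trivial
        | snd s t a =>
          obtain ⟨rfl, -⟩ := wf_snd I.wf1 hr hd
          exact absurd ⟨_, _, _, hd⟩ hsend
      obtain ⟨⟨l, q', hd⟩, hR⟩ := hrec
      have hl := hR l q' hd
      cases l with
      | snd => exact hl
      | rcv s t a =>
        have : t = r := by
          rcases hd with ⟨q, s, a', q', hd, h | h⟩ | ⟨q, s, a', q', hd, h | h⟩ <;>
            simp only [Prod.mk.injEq, Act.rcv.injEq, reduceCtorEq, false_and, and_false] at h <;>
            exact h.2.1.2.1
        subst this
        rcases gw_rcv hd with ⟨rfl, r', q', hx, hm⟩ | ⟨q', hx, hm⟩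
        · exact hsend ⟨_, _, _, hm⟩
        · have hps := pr_of_src I.hf1 hm
          rw [hps.1] at e2
          refine hu c1 hr1 ⟨t, hr, ⟨⟨_, _, by rw [e2]; exact hm⟩, by rw [e2]; exact hall⟩, ?_⟩
          intro s' a' q2 hd2
          rw [e2] at hd2
          rw [e3 _ (wf_rcv I.wf1 hr hd2).2.1 _ hr]
          exact hb s' a' _ (Or.inr ⟨_, s', a', q2, hd2, Or.inl rfl⟩)
  · rw [I.m1 r hr hH] at hrec hb
    refine hu c1 hr1 ⟨r, hr, by rw [e1 r hr hH]; exact hrec, ?_⟩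
    intro s a q' hd
    rw [e1 r hr hH] at hd
    rw [e3 _ (wf_rcv I.wf1 hr hd).2.1 _ hr]
    exact hb s a q' hd

end GTIR

/-- preservation of absence of unspecified receptions under
composition. -/
theorem stmt11_no_unspecified_reception_preserved
    {R A B : Type} [Finite R] [Finite A]
    (S1 S2 : CS R A B) (H K : R)
    (hH : H ∈ S1.roles) (hK : K ∈ S2.roles)
    (hdisj : S1.roles ∩ S2.roles = ∅)
    (hcompat : (S1.mach H).Compat (S2.mach K))
    (hwf1 : S1.WF) (hwf2 : S2.WF)
    (hfin1 : S1.FiniteSys) (hfin2 : S2.FiniteSys)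
    (hhf1 : (S1.mach H).HatFree) (hhf2 : (S2.mach K).HatFree)
    (h1 : ∀ c, Reach S1 c → ¬ UnspecConf S1 c)
    (h2 : ∀ c, Reach S2 c → ¬ UnspecConf S2 c) :
    ∀ c, Reach (CS.compose S1 S2 H K) c →
      ¬ UnspecConf (CS.compose S1 S2 H K) c := by
  have hd : ∀ p, p ∈ S1.roles → p ∈ S2.roles → False := fun p a b => by
    have : p ∈ S1.roles ∩ S2.roles := ⟨a, b⟩
    rw [hdisj] at this; exact this
  have hHK : K ≠ H := by rintro rfl; exact hd _ hH hK
  obtain ⟨hlang, nm1, nm2, d1, d2⟩ := hcompat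
  have I : IsComp (CS.compose S1 S2 H K) S1 S2 H K :=
    { hH := hH, hK := hK, dis := hd
      roles := fun p => Iff.rfl
      mH := by simp [CS.compose]
      mK := by simp [CS.compose, hHK]
      m1 := by
        intro p hp h
        have : p ≠ K := by rintro rfl; exact hd _ hp hK
        simp [CS.compose, h, this, hp]
      m2 := by
        intro p hp h
        have h3 : p ≠ H := by rintro rfl; exact hd _ hH hp
        have h4 : p ∉ S1.roles := fun h => hd _ h hp
        simp [CS.compose, h, h3, h4]
      wf1 := hwf1, wf2 := hwf2, hf1 := hhf1, hf2 := hhf2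
      nm1 := nm1, nm2 := nm2, d1 := d1, d2 := d2 }
  have hD : Dual (S1.mach H) (S2.mach K) (S1.mach H).init (S2.mach K).init := by
    intro w
    change w ∈ (S1.mach H).langNoC ↔ dualWord w ∈ (S2.mach K).langNoC
    rw [hlang]
    constructor
    · rintro ⟨v, hv, rfl⟩; rw [dualWord_dualWord]; exact hv
    · intro h; exact ⟨_, h, dualWord_dualWord w⟩
  rintro c ⟨c0, h0, hreach⟩
  have key : Proj S1 H c ∧ Proj S2 K c ∧ Inv S1 S2 H K c := by
    induction hreach with
    | refl =>
      refine ⟨proj_init I h0, proj_init I.symm h0, ?_⟩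
      have rH : H ∈ (CS.compose S1 S2 H K).roles := Or.inl hH
      have rK : K ∈ (CS.compose S1 S2 H K).roles := Or.inr hK
      have sH : c0.st H = (S1.mach H).init := by rw [h0.1 H rH, I.mH]; rfl
      have sK : c0.st K = (S2.mach K).init := by rw [h0.1 K rK, I.mK]; rfl
      unfold GTIR.Inv
      rw [sH, sK, h0.2 _ rH _ rK, h0.2 _ rK _ rH]
      obtain ⟨b, hb⟩ := hhf1.1
      obtain ⟨b', hb'⟩ := hhf2.1
      rw [hb, hb'] at hD ⊢
      exact Or.inl ⟨rfl, _, SendRun.nil _, hD⟩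
    | tail _ hs ih =>
      obtain ⟨l, hs⟩ := hs
      exact ⟨proj_step I hs ih.1, proj_step I.symm hs ih.2.1, inv_step' I hs ih.2.2⟩
  rintro ⟨r, hr, hrec, hb⟩
  rcases hr with hr | hr
  · exact no_unspec I h1 key.1 key.2.2 hr hrec hb
  · exact no_unspec I.symm h2 key.2.1 key.2.2.symm hr hrec hb
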